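/- Let m ≥ 2 and r ≥ 0 be integers and let C and D be sets of nonnegative integers such that C ∪ D = [0, m], C ∩ D = {r}, and 0 ∈ C. Then R_C(n) = R_D(n) for every positive integer n if and only if there exists a positive integer l such that m = 2^{2l+1} − 2, r = 2^{2l} − 1, C = A_{2l} ∪ (2^{2l} − 1 + B_{2l}), and D = B_{2l} ∪ (2^{2l} − 1 + A_{2l}). -/

import Mathlib

/-- `R S n` is the number of unordered representations of `n` as `s + s'`
with `s, s' ∈ S` and `s < s'`. -/
noncomputable def R (S : Set ℕ) (n : ℕ) : ℕ :=
  {p : ℕ × ℕ | p.1 ∈ S ∧ p.2 ∈ S ∧ p.1 < p.2 ∧ p.1 + p.2 = n}.ncard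

/-- The Thue–Morse set: nonnegative integers with an even number of
`1` digits in binary. -/
def A : Set ℕ := {n | Even ((Nat.digits 2 n).sum)}

/-- The complement of the Thue–Morse set. -/
def B : Set ℕ := Aᶜ

/-- `Af l = A ∩ [0, 2^l − 1]`. -/
def Af (l : ℕ) : Set ℕ := A ∩ Set.Iic (2 ^ l - 1)

/-- `Bf l = B ∩ [0, 2^l − 1]`. -/
def Bf (l : ℕ) : Set ℕ := B ∩ Set.Iic (2 ^ l - 1)

/-- `shift a S = a + S = {a + s : s ∈ S}`. -/
def shift (a : ℕ) (S : Set ℕ) : Set ℕ := (a + ·) '' S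

/-- The Thue–Morse sequence with values `±1`. -/
def thueMorse (n : ℕ) : ℤ := if Even ((Nat.digits 2 n).sum) then 1 else -1

theorem thueMorse_zero : thueMorse 0 = 1 := by simp [thueMorse]

theorem thueMorse_two_mul (n : ℕ) : thueMorse (2 * n) = thueMorse n := by
  rcases Nat.eq_zero_or_pos n with rfl | h
  · simp
  · have := Nat.digits_add 2 (by norm_num) 0 n (by norm_num) (Or.inr h.ne')
    rw [zero_add] at this
    simp [thueMorse, this]

theorem thueMorse_two_mul_add_one (n : ℕ) : thueMorse (2 * n + 1) = -thueMorse n := by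
  have := Nat.digits_add 2 (by norm_num) 1 n (by norm_num) (Or.inl one_ne_zero)
  rw [add_comm] at this
  simp only [thueMorse, this, List.sum_cons, add_comm 1, Nat.even_add_one]
  split_ifs <;> simp_all

theorem thueMorse_eq_or (n : ℕ) : thueMorse n = 1 ∨ thueMorse n = -1 := by
  unfold thueMorse
  split_ifs <;> simp

theorem mem_A_iff (n : ℕ) : n ∈ A ↔ thueMorse n = 1 := by
  simp only [A, Set.mem_ofPred_eq, thueMorse]
  split_ifs <;> simp_all

theorem mem_B_iff (n : ℕ) : n ∈ B ↔ thueMorse n = -1 := by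
  rw [B, Set.mem_compl_iff, mem_A_iff]
  have := thueMorse_eq_or n
  omega

theorem thueMorse_two_pow (k : ℕ) : thueMorse (2 ^ k) = -1 := by
  induction k with
  | zero => simpa [thueMorse_zero] using thueMorse_two_mul_add_one 0
  | succ k ih => rw [pow_succ', thueMorse_two_mul, ih]

theorem thueMorse_two_pow_sub_one (k : ℕ) : thueMorse (2 ^ k - 1) = (-1) ^ k := by
  induction k with
  | zero => simpa using thueMorse_zero
  | succ k ih =>
    have h := Nat.one_le_two_pow (n := k)
    rw [show 2 ^ (k + 1) - 1 = 2 * (2 ^ k - 1) + 1 by rw [pow_succ']; omega,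
      thueMorse_two_mul_add_one, ih, pow_succ]
    ring

theorem not_thueMorse_periodic (q : ℕ) (hq : 0 < q)
    (h : ∀ i < q, thueMorse (q + i) = thueMorse i) : False := by
  induction q using Nat.strong_induction_on with
  | _ q ih =>
    obtain ⟨k, rfl | rfl⟩ := Nat.even_or_odd' q
    · refine ih k (by omega) (by omega) fun i hi => ?_
      have := h (2 * i) (by omega)
      rwa [← mul_add, thueMorse_two_mul, thueMorse_two_mul] at this
    · have t0 := thueMorse_zero
      have t1 := thueMorse_two_mul_add_one 0
      have t2 := thueMorse_two_mul 1
      norm_num at t1 t2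
      rcases Nat.eq_zero_or_pos k with rfl | hk
      · have := h 0 (by omega)
        norm_num at this
        omega
      · have h1 := h 1 (by omega)
        have h2 := h 2 (by omega)
        rw [show 2 * k + 1 + 1 = 2 * (k + 1) by ring, thueMorse_two_mul] at h1
        rw [show 2 * k + 1 + 2 = 2 * (k + 1) + 1 by ring, thueMorse_two_mul_add_one] at h2
        omega

theorem eq_two_pow_of_thueMorse_antiperiodic (q : ℕ) (hq : 0 < q)
    (h : ∀ i < q, thueMorse (q + i) = -thueMorse i) : ∃ a, q = 2 ^ a := by
  induction q using Nat.strong_induction_on with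
  | _ q ih =>
    obtain ⟨k, rfl | rfl⟩ := Nat.even_or_odd' q
    · obtain ⟨a, rfl⟩ := ih k (by omega) (by omega) fun i hi => by
        have := h (2 * i) (by omega)
        rwa [← mul_add, thueMorse_two_mul, thueMorse_two_mul] at this
      exact ⟨a + 1, by rw [pow_succ']⟩
    · rcases Nat.eq_zero_or_pos k with rfl | hk
      · exact ⟨0, by norm_num⟩
      · exfalso
        have t0 := thueMorse_zero
        have t1 := thueMorse_two_mul_add_one 0
        have t2 := thueMorse_two_mul 1
        norm_num at t1 t2
        have h1 := h 1 (by omega)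
        have h2 := h 2 (by omega)
        rw [show 2 * k + 1 + 1 = 2 * (k + 1) by ring, thueMorse_two_mul] at h1
        rw [show 2 * k + 1 + 2 = 2 * (k + 1) + 1 by ring, thueMorse_two_mul_add_one] at h2
        omega

/-- A sequence of signs vanishing only at `r` which satisfies the recurrence coming from the
functional equation is only possible if `r = 2 ^ (2 * l) - 1` and `m < 3 * r + 2`. -/
theorem recurrence_rigidity {m r : ℕ} {p : ℕ → ℤ} (hr : 0 < r) (hm : 2 * r ≤ m) (h0 : p 0 = 1)
    (hpr : p r = 0) (hp : ∀ n ≤ m, n ≠ r → p n = 1 ∨ p n = -1)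
    (hlow : ∀ n < r, p n = (-1) ^ n * p (n / 2)) (hmid : p r + p 0 = (-1) ^ r * p (r / 2))
    (hhigh : ∀ j, r + 1 + j ≤ m →
      p (r + 1 + j) + p (j + 1) - p j = (-1) ^ (r + 1 + j) * p ((r + 1 + j) / 2)) :
    ∃ l, 0 < l ∧ r = 2 ^ (2 * l) - 1 ∧ m < 3 * r + 2 := by
  have t0 := thueMorse_zero
  have t1 := thueMorse_two_mul_add_one 0
  have t2 := thueMorse_two_mul 1
  have t3 := thueMorse_two_mul_add_one 1
  norm_num at t1 t2 t3
  have tm_step : ∀ n, thueMorse n = (-1) ^ n * thueMorse (n / 2) := by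
    intro n
    obtain ⟨k, rfl | rfl⟩ := Nat.even_or_odd' n
    · rw [thueMorse_two_mul]; simp
    · rw [thueMorse_two_mul_add_one, show (2 * k + 1) / 2 = k by omega]; simp [pow_succ]
  have hpt : ∀ n < r, p n = thueMorse n := by
    intro n
    induction n using Nat.strong_induction_on with
    | _ n ih =>
      intro hn
      rcases Nat.eq_zero_or_pos n with rfl | hn0
      · rw [h0, t0]
      · rw [hlow n hn, tm_step n, ih (n / 2) (by omega) (by omega)]
  have htr : thueMorse r = 1 := by
    rw [tm_step, ← hpt (r / 2) (by omega), ← hmid, hpr, h0]; norm_num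
  have hr1 : r ≠ 1 := by rintro rfl; omega
  have hr2 : r ≠ 2 := by rintro rfl; omega
  have hr3 : 3 ≤ r := by omega
  have hpj : ∀ j, j + 1 < r →
      p (r + 1 + j) = thueMorse (r + 1 + j) - thueMorse (j + 1) + thueMorse j := by
    intro j hj
    rw [tm_step (r + 1 + j), ← hpt (j + 1) hj, ← hpt j (by omega),
      ← hpt ((r + 1 + j) / 2) (by omega), ← hhigh j (by omega)]
    ring
  have hodd : ∀ i, 2 * i + 1 < r → thueMorse (r + 1 + 2 * i) = -thueMorse i := by
    intro i hi
    have e := hpj (2 * i) hi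
    rw [thueMorse_two_mul, thueMorse_two_mul_add_one] at e
    have := hp (r + 1 + 2 * i) (by omega) (by omega)
    have := thueMorse_eq_or i
    have := thueMorse_eq_or (r + 1 + 2 * i)
    omega
  obtain ⟨q, rfl | rfl⟩ := Nat.even_or_odd' r
  · refine (not_thueMorse_periodic q (by omega) fun i hi => ?_).elim
    have := hodd i (by omega)
    rw [show 2 * q + 1 + 2 * i = 2 * (q + i) + 1 by ring, thueMorse_two_mul_add_one] at this
    omega
  have hanti : ∀ i < q, thueMorse (q + 1 + i) = -thueMorse i := by
    intro i hi
    have := hodd i (by omega)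
    rwa [show 2 * q + 1 + 1 + 2 * i = 2 * (q + 1 + i) by ring, thueMorse_two_mul] at this
  have htq : thueMorse q = -1 := by
    rw [thueMorse_two_mul_add_one] at htr
    omega
  obtain ⟨a, ha⟩ : ∃ a, q + 1 = 2 ^ a := by
    obtain ⟨k, hk | hk⟩ := Nat.even_or_odd' (q + 1)
    · obtain ⟨a, rfl⟩ := eq_two_pow_of_thueMorse_antiperiodic k (by omega) fun i hi => by
        have := hanti (2 * i) (by omega)
        rwa [hk, ← mul_add, thueMorse_two_mul, thueMorse_two_mul] at this
      exact ⟨a + 1, by rw [hk, pow_succ']⟩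
    · exfalso
      by_cases hk1 : k = 1
      · subst hk1
        obtain rfl : q = 2 := by omega
        have := hanti 0 (by omega)
        norm_num at this
        omega
      · have h1 := hanti 1 (by omega)
        have h2 := hanti 2 (by omega)
        rw [hk, show 2 * k + 1 + 1 = 2 * (k + 1) by ring, thueMorse_two_mul] at h1
        rw [hk, show 2 * k + 1 + 2 = 2 * (k + 1) + 1 by ring, thueMorse_two_mul_add_one] at h2
        omega
  obtain rfl : q = 2 ^ a - 1 := by omega
  have hae : Odd a := by
    rw [thueMorse_two_pow_sub_one] at htq
    by_contra h
    rw [Nat.not_odd_iff_even] at h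
    rw [h.neg_one_pow] at htq
    norm_num at htq
  obtain ⟨c, rfl⟩ := hae
  have hNN : 2 ^ (2 * c + 1) = 2 * 2 ^ (2 * c) := pow_succ' 2 (2 * c)
  refine ⟨c + 1, by omega, ?_, ?_⟩
  · rw [show 2 * (c + 1) = 2 * c + 1 + 1 by ring, pow_succ' 2 (2 * c + 1)]
    have := Nat.one_le_two_pow (n := 2 * c + 1)
    generalize 2 ^ (2 * c + 1) = N at *
    omega
  by_contra! hlarge
  have tN : thueMorse (2 ^ (2 * c + 1)) = -1 := thueMorse_two_pow _
  have tK : thueMorse (2 ^ (2 * c) - 1) = 1 := by simp [thueMorse_two_pow_sub_one]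
  have hK := Nat.one_le_two_pow (n := 2 * c)
  generalize 2 ^ (2 * c) = K at *
  generalize 2 ^ (2 * c + 1) = N at *
  generalize hrN : 2 * (N - 1) + 1 = r at *
  have e1 : p (r + 1) = 1 := by
    have e := hpj 0 (by omega)
    norm_num at e
    rw [e, show r + 1 = 2 * N by omega, thueMorse_two_mul]
    omega
  have e2 : p (r + 2) = 1 := by
    have e := hpj 1 (by omega)
    norm_num at e
    rw [e, show r + 1 + 1 = 2 * N + 1 by omega, thueMorse_two_mul_add_one]
    omega
  have e3 : p (2 * r + 1) = -1 := by
    have e := hhigh r (by omega)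
    rw [show r + 1 + r = 2 * r + 1 by ring, show (2 * r + 1) / 2 = r by omega] at e
    rw [e1, hpr] at e
    omega
  have e4 : p (2 * r + 2) = 1 := by
    have e := hhigh (r + 1) (by omega)
    rw [show r + 1 + (r + 1) = 2 * (r + 1) by ring, show 2 * (r + 1) / 2 = r + 1 by omega,
      e1, e2, (even_two_mul (r + 1)).neg_one_pow] at e
    rw [show 2 * r + 2 = 2 * (r + 1) by ring]
    omega
  have e5 : p (r + N) = 1 := by
    have e := hpj (N - 1) (by omega)
    have h := hanti (K - 1) (by omega)
    rw [ha] at h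
    rw [show r + 1 + (N - 1) = r + N by omega, ha, tN, htq,
      show r + N = 2 * (N + (K - 1)) + 1 by omega, thueMorse_two_mul_add_one, h, tK] at e
    rw [show r + N = 2 * (N + (K - 1)) + 1 by omega, e]
    norm_num
  have e6 := hhigh (2 * r + 1) (by omega)
  rw [show (r + 1 + (2 * r + 1)) / 2 = r + N by omega, e5, e3,
    show 2 * r + 1 + 1 = 2 * r + 2 by ring, e4,
    show r + 1 + (2 * r + 1) = 2 * (r + N) + 1 by omega,
    (odd_two_mul_add_one (r + N)).neg_one_pow] at e6
  have := hp (2 * (r + N) + 1) (by omega) (by omega)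
  omega

section Polynomials

open Polynomial Finset

/-- The truncation of the Thue–Morse generating function to degrees below `2 ^ k`. -/
noncomputable def thueMorsePoly : ℕ → ℤ[X]
  | 0 => 1
  | k + 1 => (1 - X) * expand ℤ 2 (thueMorsePoly k)

theorem coeff_one_sub_X_mul_expand (P : ℤ[X]) (n : ℕ) :
    ((1 - X) * expand ℤ 2 P).coeff n = (-1) ^ n * P.coeff (n / 2) := by
  rw [sub_mul, one_mul, coeff_sub, coeff_expand (by norm_num)]
  rcases n with _ | n
  · simp
  rw [coeff_X_mul, coeff_expand (by norm_num)]
  obtain ⟨k, rfl | rfl⟩ := Nat.even_or_odd' n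
  · rw [if_neg (by omega), if_pos (by omega), (odd_two_mul_add_one k).neg_one_pow,
      show (2 * k + 1) / 2 = 2 * k / 2 by omega]
    ring
  · rw [if_pos (by omega), if_neg (by omega),
      show 2 * k + 1 + 1 = 2 * (k + 1) by ring, (even_two_mul (k + 1)).neg_one_pow]
    ring

theorem coeff_thueMorsePoly (k n : ℕ) :
    (thueMorsePoly k).coeff n = if n < 2 ^ k then thueMorse n else 0 := by
  induction k generalizing n with
  | zero =>
    rcases n with _ | n
    · simp [thueMorsePoly, thueMorse_zero]
    · simp [thueMorsePoly, coeff_one]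
  | succ k ih =>
    rw [thueMorsePoly, coeff_one_sub_X_mul_expand, ih, pow_succ']
    obtain ⟨j, rfl | rfl⟩ := Nat.even_or_odd' n
    · rw [(even_two_mul j).neg_one_pow, thueMorse_two_mul, show 2 * j / 2 = j by omega, one_mul]
      split_ifs <;> first | rfl | omega
    · rw [(odd_two_mul_add_one j).neg_one_pow, thueMorse_two_mul_add_one,
        show (2 * j + 1) / 2 = j by omega]
      split_ifs <;> omega

theorem one_sub_X_mul_expand_thueMorsePoly (k : ℕ) :
    (1 - X) * expand ℤ 2 (thueMorsePoly k) = thueMorsePoly k * (1 - X ^ 2 ^ k) := by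
  induction k with
  | zero => simp [thueMorsePoly]
  | succ k ih =>
    rw [thueMorsePoly, ih]
    simp only [map_mul, map_sub, map_one, map_pow, expand_X, ← pow_mul]
    rw [pow_succ', pow_mul]
    linear_combination (1 - (X ^ 2) ^ 2 ^ k) * ih

/-- The generating polynomial of `[0, m]`, with `r` counted twice. -/
noncomputable def sumPoly (m r : ℕ) : ℤ[X] := ∑ i ∈ range (m + 1), X ^ i + X ^ r

theorem one_sub_X_mul_sumPoly (m r : ℕ) :
    (1 - X) * sumPoly m r = 1 - X ^ (m + 1) + X ^ r - X ^ (r + 1) := by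
  rw [sumPoly, mul_add, mul_neg_geom_sum]
  ring

theorem one_sub_X_ne_zero : (1 - X : ℤ[X]) ≠ 0 := fun h => by
  simpa using congrArg (eval 0) h

theorem expand_thueMorsePoly_mul (k : ℕ) :
    expand ℤ 2 (thueMorsePoly k * (1 - X ^ (2 ^ k - 1))) =
      thueMorsePoly k * (1 - X ^ (2 ^ k - 1)) * sumPoly (2 ^ (k + 1) - 2) (2 ^ k - 1) := by
  refine mul_left_cancel₀ one_sub_X_ne_zero ?_
  rw [map_mul, ← mul_assoc, one_sub_X_mul_expand_thueMorsePoly, mul_left_comm,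
    one_sub_X_mul_sumPoly, pow_succ' 2 k]
  obtain ⟨N, hN⟩ : ∃ N, 2 ^ k = N + 1 := ⟨2 ^ k - 1, by have := Nat.one_le_two_pow (n := k); omega⟩
  rw [hN, show 2 * (N + 1) - 2 + 1 = 2 * N + 1 by omega, Nat.add_sub_cancel]
  simp only [map_sub, map_one, map_pow, expand_X, ← pow_mul]
  ring

/-- A solution of `W(X²) = W Q` with `Q(0) ≠ 0` vanishing at `0` is zero. -/
theorem eq_zero_of_expand_eq_mul {W Q : ℤ[X]} (h : expand ℤ 2 W = W * Q) (hW : W.coeff 0 = 0)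
    (hQ : Q.coeff 0 ≠ 0) : W = 0 := by
  by_contra hne
  obtain ⟨V, hV, hV0⟩ := exists_eq_pow_rootMultiplicity_mul_and_not_dvd W hne 0
  have ha : 0 < W.rootMultiplicity 0 :=
    (rootMultiplicity_pos hne).2 (by rwa [IsRoot, ← coeff_zero_eq_eval_zero])
  rw [C_0, sub_zero] at hV hV0
  generalize W.rootMultiplicity 0 = a at *
  subst hV
  have h' : X ^ a * expand ℤ 2 V = V * Q := by
    refine mul_left_cancel₀ (pow_ne_zero a X_ne_zero) ?_
    rw [map_mul, map_pow, expand_X] at h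
    linear_combination h
  have := congrArg (eval 0) h'
  simp only [eval_mul, eval_pow, eval_X, zero_pow ha.ne', zero_mul] at this
  rw [X_dvd_iff, coeff_zero_eq_eval_zero] at hV0
  rw [coeff_zero_eq_eval_zero] at hQ
  exact mul_ne_zero hV0 hQ this.symm

/-- A nonzero solution of `P(X²) = P Q` forces `Q(1)` to be a power of two. -/
theorem eval_one_eq_two_pow_of_expand_eq_mul {P Q : ℤ[X]} (h : expand ℤ 2 P = P * Q)
    (hP : P ≠ 0) : ∃ k, Q.eval 1 = 2 ^ k := by
  obtain ⟨V, hV, hV1⟩ := exists_eq_pow_rootMultiplicity_mul_and_not_dvd P hP 1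
  generalize P.rootMultiplicity 1 = k at *
  subst hV
  refine ⟨k, ?_⟩
  have h' : (X + 1) ^ k * expand ℤ 2 V = V * Q := by
    refine mul_left_cancel₀ (pow_ne_zero k (X_sub_C_ne_zero 1)) ?_
    rw [map_mul, map_pow, map_sub, expand_X, expand_C] at h
    rw [← mul_assoc, ← mul_pow, ← mul_assoc, ← h]
    congr 2
    simp only [map_one]
    ring
  have h1 := congrArg (eval 1) h'
  rw [dvd_iff_isRoot, IsRoot] at hV1
  simp only [eval_mul, eval_pow, eval_add, eval_X, eval_one, expand_eval, one_pow] at h1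
  refine mul_left_cancel₀ hV1 ?_
  rw [← h1]
  norm_num [mul_comm]

theorem sumPoly_eval_one (m r : ℕ) : (sumPoly m r).eval 1 = m + 2 := by
  simp [sumPoly, eval_finsetSum]
  ring

theorem sumPoly_coeff_zero_ne_zero (m r : ℕ) : (sumPoly m r).coeff 0 ≠ 0 := by
  simp only [sumPoly, coeff_add, finsetSum_coeff, coeff_X_pow, sum_ite_eq, mem_range]
  split_ifs <;> simp_all

theorem eq_of_expand_eq_mul {m r : ℕ} {P : ℤ[X]} (hP : expand ℤ 2 P = P * sumPoly m r)
    (hm : 2 * r ≤ m) (hm2 : 2 ≤ m) (h0 : P.coeff 0 = 1) (hr0 : P.coeff r = 0)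
    (hp : ∀ n ≤ m, n ≠ r → P.coeff n = 1 ∨ P.coeff n = -1) :
    ∃ l, 0 < l ∧ m = 2 ^ (2 * l + 1) - 2 ∧ r = 2 ^ (2 * l) - 1 ∧
      P = thueMorsePoly (2 * l) * (1 - X ^ (2 ^ (2 * l) - 1)) := by
  have hr : 0 < r := Nat.pos_of_ne_zero fun h => by subst h; omega
  have key : ∀ n, P.coeff n - (if m + 1 ≤ n then P.coeff (n - (m + 1)) else 0) +
      (if r ≤ n then P.coeff (n - r) else 0) - (if r + 1 ≤ n then P.coeff (n - (r + 1)) else 0) =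
      (-1) ^ n * P.coeff (n / 2) := by
    intro n
    rw [← coeff_one_sub_X_mul_expand, hP, mul_left_comm, one_sub_X_mul_sumPoly, mul_sub, mul_add,
      mul_sub, mul_one, coeff_sub, coeff_add, coeff_sub, coeff_mul_X_pow', coeff_mul_X_pow',
      coeff_mul_X_pow']
  obtain ⟨l, hl, hrl, hlt⟩ := recurrence_rigidity (p := P.coeff) hr hm h0 hr0 hp
    (fun n hn => by
      have := key n
      rw [if_neg (by omega), if_neg (by omega), if_neg (by omega)] at this
      linarith)
    (by
      have := key r
      rw [if_neg (by omega), if_pos le_rfl, if_neg (by omega), Nat.sub_self] at this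
      linarith)
    (fun j hj => by
      have := key (r + 1 + j)
      rw [if_neg (by omega), if_pos (by omega), if_pos (by omega),
        show r + 1 + j - r = j + 1 by omega, show r + 1 + j - (r + 1) = j by omega] at this
      linarith)
  obtain ⟨k, hk⟩ := eval_one_eq_two_pow_of_expand_eq_mul hP (fun h => by simp [h] at h0)
  rw [sumPoly_eval_one] at hk
  replace hk : m + 2 = 2 ^ k := by exact_mod_cast hk
  have hr1 : r + 1 = 2 ^ (2 * l) := by
    have := Nat.one_le_two_pow (n := 2 * l)
    omega
  have hk1 : 2 * l + 1 ≤ k := by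
    refine (Nat.pow_le_pow_iff_right (a := 2) (by norm_num)).1 ?_
    rw [← hk, pow_succ', ← hr1]
    omega
  have hk2 : k < 2 * l + 2 := by
    refine (Nat.pow_lt_pow_iff_right (a := 2) (by norm_num)).1 ?_
    rw [← hk, pow_succ', pow_succ', ← hr1]
    omega
  obtain rfl : k = 2 * l + 1 := by omega
  have hml : m = 2 ^ (2 * l + 1) - 2 := by omega
  refine ⟨l, hl, hml, hrl, ?_⟩
  have hT := expand_thueMorsePoly_mul (2 * l)
  rw [← hml, ← hrl] at hT
  rw [← hrl, ← sub_eq_zero]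
  refine eq_zero_of_expand_eq_mul (Q := sumPoly m r) ?_ ?_ (sumPoly_coeff_zero_ne_zero m r)
  · rw [map_sub, hP, hT, sub_mul]
  · rw [coeff_sub, h0, mul_sub, mul_one, coeff_sub, coeff_mul_X_pow', coeff_thueMorsePoly,
      if_pos (by positivity), if_neg (by omega), thueMorse_zero]
    norm_num

open Classical in
/-- The generating polynomial of `S ∩ [0, m]`. -/
noncomputable def genPoly (m : ℕ) (S : Set ℕ) : ℤ[X] :=
  ∑ i ∈ range (m + 1), if i ∈ S then X ^ i else 0

open Classical in
theorem coeff_genPoly {m : ℕ} {S : Set ℕ} (hS : S ⊆ Set.Iic m) (n : ℕ) :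
    (genPoly m S).coeff n = if n ∈ S then 1 else 0 := by
  rw [genPoly, finsetSum_coeff]
  rw [sum_congr rfl (g := fun i => if n = i then (if n ∈ S then (1 : ℤ) else 0) else 0)]
  · rw [sum_ite_eq]
    by_cases h : n ∈ S
    · have : n ≤ m := hS h
      simp [h, this]
    · simp [h]
  · intro i _
    by_cases h : n = i
    · subst h
      by_cases hn : n ∈ S <;> simp [hn]
    · split_ifs <;> simp [coeff_X_pow, h]

theorem coeff_genPoly_sq_sub_expand {m : ℕ} {S : Set ℕ} (hS : S ⊆ Set.Iic m) (n : ℕ) :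
    (genPoly m S ^ 2 - expand ℤ 2 (genPoly m S)).coeff n = 2 * R S n := by
  classical
  have hR : R S n = #{p ∈ antidiagonal n | (p.1 ∈ S ∧ p.2 ∈ S) ∧ p.1 < p.2} := by
    rw [R, ← Set.ncard_coe_finset]
    congr 1
    ext p
    simp only [Set.mem_ofPred_eq, coe_filter, HasAntidiagonal.mem_antidiagonal]
    tauto
  have hR' : R S n = #{p ∈ antidiagonal n | (p.1 ∈ S ∧ p.2 ∈ S) ∧ p.2 < p.1} := by
    rw [hR]
    refine card_bij' (fun p _ => p.swap) (fun p _ => p.swap) ?_ ?_ ?_ ?_ <;>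
      simp +contextual [add_comm]
  have hdiag : (#{p ∈ antidiagonal n | (p.1 ∈ S ∧ p.2 ∈ S) ∧ p.1 = p.2} : ℤ) =
      (expand ℤ 2 (genPoly m S)).coeff n := by
    rw [coeff_expand (by norm_num), coeff_genPoly hS]
    split_ifs with h1 h2
    · obtain ⟨k, rfl⟩ := h1
      rw [Nat.mul_div_cancel_left k (by norm_num)] at h2
      rw [show ({p ∈ antidiagonal (2 * k) | (p.1 ∈ S ∧ p.2 ∈ S) ∧ p.1 = p.2}) = {(k, k)} from ?_]
      · simp
      · ext ⟨a, b⟩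
        simp only [mem_filter, HasAntidiagonal.mem_antidiagonal, mem_singleton, Prod.mk.injEq]
        refine ⟨fun h => by omega, ?_⟩
        rintro ⟨rfl, rfl⟩
        exact ⟨by ring, ⟨h2, h2⟩, rfl⟩
    · rw [filter_false_of_mem]
      · simp
      · rintro ⟨a, b⟩ h ⟨⟨ha, _⟩, hab⟩
        rw [HasAntidiagonal.mem_antidiagonal] at h
        exact h2 (by rwa [show n / 2 = a by simp only at h hab; omega])
    · rw [filter_false_of_mem]
      · simp
      · rintro ⟨a, b⟩ h ⟨_, hab⟩
        rw [HasAntidiagonal.mem_antidiagonal] at h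
        exact h1 ⟨a, by simp only at h hab; omega⟩
  have hall : ((genPoly m S) ^ 2).coeff n =
      (#{p ∈ antidiagonal n | p.1 ∈ S ∧ p.2 ∈ S} : ℤ) := by
    rw [sq, coeff_mul, card_filter]
    push_cast
    refine sum_congr rfl fun p _ => ?_
    rw [coeff_genPoly hS, coeff_genPoly hS]
    split_ifs <;> simp_all
  have hsplit : #{p ∈ antidiagonal n | p.1 ∈ S ∧ p.2 ∈ S} = R S n + R S n +
      #{p ∈ antidiagonal n | (p.1 ∈ S ∧ p.2 ∈ S) ∧ p.1 = p.2} := by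
    nth_rw 1 [hR]
    rw [hR', ← card_union_of_disjoint, ← card_union_of_disjoint, ← filter_or, ← filter_or]
    · congr 1
      refine filter_congr fun p _ => ?_
      have := lt_trichotomy p.1 p.2
      tauto
    · rw [← filter_or, disjoint_filter]
      omega
    · rw [disjoint_filter]
      omega
  rw [coeff_sub, hall, ← hdiag, hsplit]
  push_cast
  ring

theorem forall_R_eq_iff_expand {m : ℕ} {C D : Set ℕ} (hC : C ⊆ Set.Iic m) (hD : D ⊆ Set.Iic m) :
    (∀ n : ℕ, 0 < n → R C n = R D n) ↔
      expand ℤ 2 (genPoly m C - genPoly m D) =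
        (genPoly m C - genPoly m D) * (genPoly m C + genPoly m D) := by
  have hzero : ∀ S, R S 0 = 0 := fun S => by
    rw [R, show {p : ℕ × ℕ | p.1 ∈ S ∧ p.2 ∈ S ∧ p.1 < p.2 ∧ p.1 + p.2 = 0} = ∅ by
      ext p; simp only [Set.mem_ofPred_eq, Set.mem_empty_iff_false, iff_false]; omega, Set.ncard_empty]
  trans genPoly m C ^ 2 - expand ℤ 2 (genPoly m C) = genPoly m D ^ 2 - expand ℤ 2 (genPoly m D)
  · rw [Polynomial.ext_iff]
    refine forall_congr' fun n => ?_
    rw [coeff_genPoly_sq_sub_expand hC, coeff_genPoly_sq_sub_expand hD]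
    rcases Nat.eq_zero_or_pos n with rfl | hn
    · simp [hzero]
    · simp [hn]
  · rw [map_sub]
    constructor <;> intro h <;> linear_combination -h

theorem genPoly_add_genPoly {m r : ℕ} {C D : Set ℕ} (hU : C ∪ D = Set.Iic m)
    (hI : C ∩ D = {r}) : genPoly m C + genPoly m D = sumPoly m r := by
  classical
  ext n
  have h1 := Set.ext_iff.1 hU n
  have h2 := Set.ext_iff.1 hI n
  simp only [Set.mem_union, Set.mem_Iic, Set.mem_inter_iff, Set.mem_singleton_iff] at h1 h2
  rw [coeff_add, coeff_genPoly (hU ▸ Set.subset_union_left),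
    coeff_genPoly (hU ▸ Set.subset_union_right), sumPoly]
  simp only [coeff_add, finsetSum_coeff, coeff_X_pow, sum_ite_eq, mem_range, Nat.lt_succ_iff,
    ← h1, ← h2]
  split_ifs <;> simp_all

theorem genPoly_sub_genPoly_eq_iff {k m r : ℕ} {C D : Set ℕ} (hk : Even k)
    (hm : m = 2 ^ (k + 1) - 2) (hr : r = 2 ^ k - 1) (hU : C ∪ D = Set.Iic m) (hI : C ∩ D = {r}) :
    genPoly m C - genPoly m D = thueMorsePoly k * (1 - X ^ (2 ^ k - 1)) ↔
      C = Af k ∪ shift (2 ^ k - 1) (Bf k) ∧ D = Bf k ∪ shift (2 ^ k - 1) (Af k) := by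
  classical
  have htr : thueMorse r = 1 := by rw [hr, thueMorse_two_pow_sub_one, hk.neg_one_pow]
  have h0 := thueMorse_zero
  have mem_shift : ∀ (S : Set ℕ) (n : ℕ), n ∈ shift r S ↔ r ≤ n ∧ n - r ∈ S := by
    intro S n
    constructor
    · rintro ⟨s, hs, rfl⟩
      exact ⟨Nat.le_add_right r s, by rwa [Nat.add_sub_cancel_left]⟩
    · rintro ⟨h, hs⟩
      exact ⟨n - r, hs, Nat.add_sub_cancel' h⟩
  rw [← hr, Polynomial.ext_iff, Set.ext_iff, Set.ext_iff, ← forall_and]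
  refine forall_congr' fun n => ?_
  have h1 := Set.ext_iff.1 hU n
  have h2 := Set.ext_iff.1 hI n
  simp only [Set.mem_union, Set.mem_Iic, Set.mem_inter_iff, Set.mem_singleton_iff] at h1 h2
  have hr1 : 2 ^ k = r + 1 := by
    have := Nat.one_le_two_pow (n := k)
    omega
  have hm2 : m = 2 * r := by rw [hm, pow_succ', hr1]; omega
  rw [coeff_sub, coeff_genPoly (hU ▸ Set.subset_union_left),
    coeff_genPoly (hU ▸ Set.subset_union_right), mul_sub, mul_one, coeff_sub, coeff_mul_X_pow',
    coeff_thueMorsePoly, coeff_thueMorsePoly]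
  simp only [Set.mem_union, mem_shift, Af, Bf, Set.mem_inter_iff, mem_A_iff, mem_B_iff,
    Set.mem_Iic, hr1, Nat.add_sub_cancel]
  rw [hm2] at h1
  rcases lt_trichotomy n r with h | h | h
  · have ht := thueMorse_eq_or n
    have h3 : ¬ r ≤ n := by omega
    have h4 : n < r + 1 := by omega
    have h5 : n ≤ r := h.le
    have h6 : n ≤ 2 * r := by omega
    simp only [h3, h4, h5, h6, h.ne, iff_true, iff_false, if_true, if_false] at h1 h2 ⊢
    rcases ht with e | e <;> by_cases hC : n ∈ C <;> by_cases hD : n ∈ D <;>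
        first
        | exact (h2 ⟨hC, hD⟩).elim
        | exact (h1.elim hC hD).elim
        | simp [hC, hD, e]
  · subst h
    have := h2.2 rfl
    simp [this.1, this.2, htr, h0]
  · have ht := thueMorse_eq_or (n - r)
    have h3 : ¬ n ≤ r := by omega
    have h4 : ¬ n < r + 1 := by omega
    simp only [h3, h4, h.le, h.ne', iff_false, if_true, if_false] at h1 h2 ⊢
    by_cases h6 : n ≤ 2 * r
    · have h7 : n - r < r + 1 := by omega
      have h8 : n - r ≤ r := by omega
      simp only [h6, h7, h8, iff_true, if_true] at h1 ⊢
      rcases ht with e | e <;> by_cases hC : n ∈ C <;> by_cases hD : n ∈ D <;>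
        first
        | exact (h2 ⟨hC, hD⟩).elim
        | exact (h1.elim hC hD).elim
        | simp [hC, hD, e]
    · have h7 : ¬ n - r < r + 1 := by omega
      have h8 : ¬ n - r ≤ r := by omega
      simp only [h6, h7, h8, iff_false, if_false] at h1 ⊢
      rw [not_or] at h1
      simp [h1.1, h1.2]

theorem genPoly_eq_of_forall_R_eq {m r : ℕ} (hm : 2 ≤ m) {C D : Set ℕ}
    (hU : C ∪ D = Set.Iic m) (hI : C ∩ D = {r}) (h0 : 0 ∈ C) (hrm : 2 * r ≤ m)
    (h : ∀ n : ℕ, 0 < n → R C n = R D n) :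
    ∃ l, 0 < l ∧ m = 2 ^ (2 * l + 1) - 2 ∧ r = 2 ^ (2 * l) - 1 ∧
      genPoly m C - genPoly m D = thueMorsePoly (2 * l) * (1 - X ^ (2 ^ (2 * l) - 1)) := by
  classical
  have hC : C ⊆ Set.Iic m := hU ▸ Set.subset_union_left
  have hD : D ⊆ Set.Iic m := hU ▸ Set.subset_union_right
  have hP := (forall_R_eq_iff_expand hC hD).1 h
  rw [genPoly_add_genPoly hU hI] at hP
  have hU' := fun n => Set.ext_iff.1 hU n
  have hI' := fun n => Set.ext_iff.1 hI n
  simp only [Set.mem_union, Set.mem_Iic, Set.mem_inter_iff, Set.mem_singleton_iff] at hU' hI'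
  have hcoeff : ∀ n, (genPoly m C - genPoly m D).coeff n =
      (if n ∈ C then 1 else 0) - (if n ∈ D then 1 else 0) := fun n => by
    rw [coeff_sub, coeff_genPoly hC, coeff_genPoly hD]
  have hpr : (genPoly m C - genPoly m D).coeff r = 0 := by
    have := (hI' r).2 rfl
    simp [hcoeff, this.1, this.2]
  have hp : ∀ n ≤ m, n ≠ r → (genPoly m C - genPoly m D).coeff n = 1 ∨
      (genPoly m C - genPoly m D).coeff n = -1 := by
    intro n hn hnr
    have h1 := (hU' n).2 hn
    have h2 := mt (hI' n).1 hnr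
    rw [hcoeff]
    split_ifs <;> simp_all
  have hr0 : r ≠ 0 := by
    rintro rfl
    have hz := eq_zero_of_expand_eq_mul hP hpr (sumPoly_coeff_zero_ne_zero m 0)
    have := hp 1 (by omega) (by omega)
    simp [hz] at this
  refine eq_of_expand_eq_mul hP hrm hm ?_ hpr hp
  have : 0 ∉ D := fun hD0 => hr0 ((hI' 0).1 ⟨h0, hD0⟩).symm
  simp [hcoeff, h0, this]

end Polynomials

theorem R_reflect {m n : ℕ} {S : Set ℕ} (hS : S ⊆ Set.Iic m) (hn : n ≤ 2 * m) :
    R {x | x ≤ m ∧ m - x ∈ S} n = R S (2 * m - n) := by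
  unfold R
  refine Set.ncard_congr (fun p _ => (m - p.2, m - p.1)) ?_ ?_ ?_
  · rintro ⟨a, b⟩ ⟨⟨ha, ha'⟩, ⟨hb, hb'⟩, hlt, hs⟩
    exact ⟨hb', ha', by simp only at *; omega, by simp only at *; omega⟩
  · rintro ⟨a, b⟩ ⟨c, d⟩ ⟨⟨ha, ha'⟩, ⟨hb, hb'⟩, hlt, hs⟩ ⟨⟨hc, hc'⟩, ⟨hd, hd'⟩, hlt', hs'⟩ h
    simp only [Prod.mk.injEq] at *
    omega
  · rintro ⟨a, b⟩ ⟨ha, hb, hlt, hs⟩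
    have ha' : a ≤ m := hS ha
    have hb' : b ≤ m := hS hb
    simp only at *
    refine ⟨(m - b, m - a), ⟨⟨by omega, ?_⟩, ⟨by omega, ?_⟩, ?_, ?_⟩, ?_⟩
    · rwa [Nat.sub_sub_self hb']
    · rwa [Nat.sub_sub_self ha']
    · simp only; omega
    · simp only; omega
    · rw [Nat.sub_sub_self hb', Nat.sub_sub_self ha']

theorem two_mul_le_of_forall_R_eq {m r : ℕ} (hm : 2 ≤ m) {C D : Set ℕ}
    (hU : C ∪ D = Set.Iic m) (hI : C ∩ D = {r}) (h : ∀ n : ℕ, 0 < n → R C n = R D n) :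
    2 * r ≤ m := by
  by_contra! hlt
  have hC : C ⊆ Set.Iic m := hU ▸ Set.subset_union_left
  have hD : D ⊆ Set.Iic m := hU ▸ Set.subset_union_right
  have hU' := fun n => Set.ext_iff.1 hU n
  have hI' := fun n => Set.ext_iff.1 hI n
  simp only [Set.mem_union, Set.mem_Iic, Set.mem_inter_iff, Set.mem_singleton_iff] at hU' hI'
  have hrm : r ≤ m := (hU' r).1 (Or.inl ((hI' r).2 rfl).1)
  set C' : Set ℕ := {x | x ≤ m ∧ m - x ∈ C} with hC'
  set D' : Set ℕ := {x | x ≤ m ∧ m - x ∈ D} with hD'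
  have hUr : C' ∪ D' = Set.Iic m := by
    ext n
    simp only [hC', hD', Set.mem_union, Set.mem_ofPred_eq, Set.mem_Iic]
    have := hU' (m - n)
    have := Nat.sub_le m n
    tauto
  have hIr : C' ∩ D' = {m - r} := by
    ext n
    simp only [hC', hD', Set.mem_inter_iff, Set.mem_ofPred_eq, Set.mem_singleton_iff]
    have := hI' (m - n)
    have : n ≤ m ∧ m - n = r ↔ n = m - r := by omega
    tauto
  have hlarge : ∀ (S : Set ℕ) (n : ℕ), S ⊆ Set.Iic m → 2 * m ≤ n → R S n = 0 := by
    intro S n hS hn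
    rw [R, show {p : ℕ × ℕ | p.1 ∈ S ∧ p.2 ∈ S ∧ p.1 < p.2 ∧ p.1 + p.2 = n} = ∅ from ?_,
      Set.ncard_empty]
    ext p
    simp only [Set.mem_ofPred_eq, Set.mem_empty_iff_false, iff_false]
    rintro ⟨h1, h2, h3, h4⟩
    have h1' : p.1 ≤ m := hS h1
    have h2' : p.2 ≤ m := hS h2
    omega
  have hR : ∀ n : ℕ, 0 < n → R C' n = R D' n := by
    intro n _
    rcases lt_or_ge n (2 * m) with hn | hn
    · rw [R_reflect hC hn.le, R_reflect hD hn.le]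
      exact h _ (by omega)
    · rw [hlarge C' n (fun x hx => hx.1) hn, hlarge D' n (fun x hx => hx.1) hn]
  have hcontra : ∀ l, m = 2 ^ (2 * l + 1) - 2 → m - r = 2 ^ (2 * l) - 1 → False := by
    intro l h1 h2
    rw [pow_succ'] at h1
    omega
  rcases (hU' m).2 le_rfl with h0 | h0
  · obtain ⟨l, -, h1, h2, -⟩ :=
      genPoly_eq_of_forall_R_eq hm hUr hIr ⟨Nat.zero_le m, h0⟩ (by omega) hR
    exact hcontra l h1 h2
  · obtain ⟨l, -, h1, h2, -⟩ :=
      genPoly_eq_of_forall_R_eq hm ((Set.union_comm D' C').trans hUr) ((Set.inter_comm D' C').trans hIr)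
        ⟨Nat.zero_le m, h0⟩ (by omega) fun n hn => (hR n hn).symm
    exact hcontra l h1 h2

theorem chen_lev_problem (m r : ℕ) (hm : 2 ≤ m) (C D : Set ℕ)
    (hU : C ∪ D = Set.Iic m) (hI : C ∩ D = {r}) (h0 : (0 : ℕ) ∈ C) :
    (∀ n : ℕ, 0 < n → R C n = R D n) ↔
      ∃ l : ℕ, 0 < l ∧ m = 2 ^ (2 * l + 1) - 2 ∧ r = 2 ^ (2 * l) - 1 ∧
        C = Af (2 * l) ∪ shift (2 ^ (2 * l) - 1) (Bf (2 * l)) ∧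
        D = Bf (2 * l) ∪ shift (2 ^ (2 * l) - 1) (Af (2 * l)) := by
  constructor
  · intro h
    obtain ⟨l, hl, hml, hrl, hP⟩ :=
      genPoly_eq_of_forall_R_eq hm hU hI h0 (two_mul_le_of_forall_R_eq hm hU hI h) h
    exact ⟨l, hl, hml, hrl, (genPoly_sub_genPoly_eq_iff (even_two_mul l) hml hrl hU hI).1 hP⟩
  · rintro ⟨l, -, hml, hrl, hCD⟩
    rw [forall_R_eq_iff_expand (hU ▸ Set.subset_union_left) (hU ▸ Set.subset_union_right),
      (genPoly_sub_genPoly_eq_iff (even_two_mul l) hml hrl hU hI).2 hCD,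
      genPoly_add_genPoly hU hI, expand_thueMorsePoly_mul, ← hml, ← hrl]
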